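/- For every m ≥ 1, the logic LTL_NT(m) is decidable with respect to admissibility of inference rules: there is an algorithm which, given any inference rule r = φ₁,…,φ_l / ψ, decides whether r is admissible in LTL_NT(m). -/

import Mathlib

/-- LTL formulas: letters, falsum, implication, Next, Until.
Other Boolean connectives are defined as abbreviations. -/
inductive Fml : Type
  | letter : ℕ → Fml
  | bot : Fml
  | imp : Fml → Fml → Fml
  | next : Fml → Fml
  | untl : Fml → Fml → Fml
deriving DecidableEq

namespace Fml
def neg (φ : Fml) : Fml := imp φ bot
def top : Fml := neg bot
def conj (φ ψ : Fml) : Fml := neg (imp φ (neg ψ))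
def disj (φ ψ : Fml) : Fml := imp (neg φ) ψ
/-- □φ abbreviates ¬(⊤ U ¬φ). -/
def box (φ : Fml) : Fml := neg (untl top (neg φ))
end Fml

/-- Truth in a model on the non-transitive linear frame determined by `t : ℕ → ℕ`:
`φ U ψ` at `a` looks only as far as `t a`. -/
def sat (t : ℕ → ℕ) (V : ℕ → Set ℕ) : Fml → ℕ → Prop
  | .letter p, a => a ∈ V p
  | .bot, _ => False
  | .imp φ ψ, a => sat t V φ a → sat t V ψ a
  | .next φ, a => sat t V φ (a + 1)
  | .untl φ ψ, a => ∃ b, a ≤ b ∧ b ≤ t a ∧ sat t V ψ b ∧ ∀ c, a ≤ c → c < b → sat t V φ c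

/-- A non-transitive linear frame: `t i > i` and `t` is increasing on successive points. -/
def NTFrame (t : ℕ → ℕ) : Prop := (∀ i, i < t i) ∧ (∀ i, t i < t (i + 1))

/-- The logic LTL_NT. -/
def LTLNT : Set Fml := {φ | ∀ t, NTFrame t → ∀ V a, sat t V φ a}

/-- Standard LTL semantics on ⟨ℕ, ≤, Next⟩. -/
def satStd (V : ℕ → Set ℕ) : Fml → ℕ → Prop
  | .letter p, a => a ∈ V p
  | .bot, _ => False
  | .imp φ ψ, a => satStd V φ a → satStd V ψ a
  | .next φ, a => satStd V φ (a + 1)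
  | .untl φ ψ, a => ∃ b, a ≤ b ∧ satStd V ψ b ∧ ∀ c, a ≤ c → c < b → satStd V φ c

/-- The standard linear temporal logic LTL. -/
def LTL : Set Fml := {φ | ∀ V a, satStd V φ a}

/-- The logic LTL_NT(m) of uniform intransitivity `m` (frame with `t i = i + m`). -/
def LTLNTm (m : ℕ) : Set Fml := {φ | ∀ V a, sat (· + m) V φ a}

/-- An inference rule: a finite list of premises and a conclusion. -/
structure Rule where
  prem : List Fml
  concl : Fml

/-- A rule is valid in a model iff truth of all premises at all points implies
truth of the conclusion at all points. -/
def validInModel (t : ℕ → ℕ) (V : ℕ → Set ℕ) (r : Rule) : Prop :=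
  (∀ φ ∈ r.prem, ∀ a, sat t V φ a) → ∀ a, sat t V r.concl a

/-- A rule is valid in a frame iff it is valid in every model on it. -/
def validInFrame (t : ℕ → ℕ) (r : Rule) : Prop := ∀ V, validInModel t V r

/-- Size of a formula. -/
def Fml.size : Fml → ℕ
  | .letter _ => 1
  | .bot => 1
  | .imp φ ψ => φ.size + ψ.size + 1
  | .next φ => φ.size + 1
  | .untl φ ψ => φ.size + ψ.size + 1

/-- Size of a rule. -/
def Rule.size (r : Rule) : ℕ := (r.prem.map Fml.size).sum + r.concl.size

/-- An injective encoding of formulas into ℕ (to speak about computability). -/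
def encF : Fml → ℕ
  | .letter p => Nat.pair 0 p
  | .bot => Nat.pair 1 0
  | .imp φ ψ => Nat.pair 2 (Nat.pair (encF φ) (encF ψ))
  | .next φ => Nat.pair 3 (encF φ)
  | .untl φ ψ => Nat.pair 4 (Nat.pair (encF φ) (encF ψ))

def encL : List Fml → ℕ
  | [] => 0
  | φ :: l => Nat.pair (encF φ) (encL l) + 1

/-- An injective encoding of rules into ℕ. -/
def encRule (r : Rule) : ℕ := Nat.pair (encL r.prem) (encF r.concl)

/-- A literal: `φ` or `¬φ` according to a Boolean flag (`α⁰ = α`, `α¹ = ¬α`). -/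
def lit (b : Bool) (φ : Fml) : Fml := if b then φ else φ.neg

/-- Conjunction of a list of formulas. -/
def bigConj : List Fml → Fml
  | [] => Fml.top
  | φ :: l => (bigConj l).conj φ

/-- Disjunction of a list of formulas. -/
def bigDisj : List Fml → Fml
  | [] => Fml.bot
  | φ :: l => (bigDisj l).disj φ

/-- The premise of a rule in reduced normal form: a disjunction over `j < l` of
conjunctions of literals over `xᵢ`, `N xᵢ` (for `i < n`) and `xᵢ U x_k` (for `i ≠ k`). -/
def rnfPremise (n l : ℕ) (t0 t1 : Fin l → Fin n → Bool)
    (t2 : Fin l → Fin n → Fin n → Bool) : Fml :=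
  bigDisj ((List.finRange l).map fun j =>
    bigConj ((List.finRange n).map (fun i => lit (t0 j i) (.letter i)) ++
      (List.finRange n).map (fun i => lit (t1 j i) (.next (.letter i))) ++
      ((List.finRange n).flatMap fun i =>
        ((List.finRange n).filter (fun k => k ≠ i)).map fun k =>
          lit (t2 j i k) (.untl (.letter i) (.letter k))))) 

/-- `IsRNF n l r`: the rule `r` is in reduced normal form with `n` letters and
`l` disjuncts, i.e. of the shape `ε / x₁`. -/
def IsRNF (n l : ℕ) (r : Rule) : Prop :=
  0 < n ∧ 0 < l ∧ r.concl = .letter 0 ∧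
    ∃ t0 t1 t2, r.prem = [rnfPremise n l t0 t1 t2]

/-- Next relation of the finite frame ℱ(N(r)): it wraps the last point `T` to `g`. -/
def wNext (T g : ℕ) (a : ℕ) : ℕ := if a = T then g else a + 1

/-- Truth in a model on the finite frame `ℱ(N(r))` obtained from the frame of `t`:
the base set is `[0, t^[r+1] 0]`, `T = t^[r+1] 0` is the last point, whose `Next` is
`G = t^[g] 0`; `until` from `a` follows `wNext` for at most `t a - a` steps, so on the
last interval it acts as if the interval following it were `[t^[g] 0, t^[g+1] 0]`. -/
def satFin (t : ℕ → ℕ) (T G : ℕ) (V : ℕ → Set ℕ) : Fml → ℕ → Prop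
  | .letter p, a => a ∈ V p
  | .bot, _ => False
  | .imp φ ψ, a => satFin t T G V φ a → satFin t T G V ψ a
  | .next φ, a => satFin t T G V φ (wNext T G a)
  | .untl φ ψ, a => ∃ k, k ≤ t a - a ∧ satFin t T G V ψ ((wNext T G)^[k] a) ∧
      ∀ j < k, satFin t T G V φ ((wNext T G)^[j] a)

/-- `r` is refuted by `V` in the finite frame `ℱ(N(rr))` (with parameter `g`) built
from the frame of `t`: all premises hold at every point of the frame, while the
conclusion fails at some point. -/
def refutedFin (t : ℕ → ℕ) (rr g : ℕ) (V : ℕ → Set ℕ) (r : Rule) : Prop :=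
  (∀ φ ∈ r.prem, ∀ a ≤ t^[rr + 1] 0, satFin t (t^[rr + 1] 0) (t^[g] 0) V φ a) ∧
    ∃ a ≤ t^[rr + 1] 0, ¬ satFin t (t^[rr + 1] 0) (t^[g] 0) V r.concl a

/-- Temporal degree: maximal nesting depth of `N` and `U`. -/
def tdeg : Fml → ℕ
  | .letter _ => 0
  | .bot => 0
  | .imp φ ψ => max (tdeg φ) (tdeg ψ)
  | .next φ => tdeg φ + 1
  | .untl φ ψ => max (tdeg φ) (tdeg ψ) + 1

/-- `i`-fold application of `N`. -/
def nPow : ℕ → Fml → Fml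
  | 0, φ => φ
  | k + 1, φ => .next (nPow k φ)

/-- Substitution of formulas for letters. -/
def subst (σ : ℕ → Fml) : Fml → Fml
  | .letter p => σ p
  | .bot => .bot
  | .imp φ ψ => .imp (subst σ φ) (subst σ ψ)
  | .next φ => .next (subst σ φ)
  | .untl φ ψ => .untl (subst σ φ) (subst σ ψ)

/-- A rule is admissible in a logic `L` iff every substitution making all premises
theorems of `L` makes the conclusion a theorem of `L`. -/
def Admissible (L : Set Fml) (r : Rule) : Prop :=
  ∀ σ : ℕ → Fml, (∀ φ ∈ r.prem, subst σ φ ∈ L) → subst σ r.concl ∈ L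

namespace Adm15

theorem lt_pair_left (t x : ℕ) (ht : 1 ≤ t) : x + 1 ≤ Nat.pair t x := by
  have := Nat.add_le_pair t x
  omega

theorem loc (m : ℕ) (φ : Fml) : ∀ (V V' : ℕ → Set ℕ) (a a' : ℕ),
    (∀ p ≤ encF φ, ∀ k ≤ (m + 1) * encF φ, (a + k ∈ V p ↔ a' + k ∈ V' p)) →
    (sat (· + m) V φ a ↔ sat (· + m) V' φ a') := by
  induction φ with
  | letter p =>
    intro V V' a a' h
    have := h p (by simpa [encF] using Nat.right_le_pair 0 p) 0 (Nat.zero_le _)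
    simpa [sat] using this
  | bot => intro V V' a a' h; simp [sat]
  | imp φ ψ ih1 ih2 =>
    intro V V' a a' h
    have h1 : encF φ ≤ encF (.imp φ ψ) :=
      (Nat.left_le_pair _ _).trans (Nat.right_le_pair _ _)
    have h2 : encF ψ ≤ encF (.imp φ ψ) :=
      (Nat.right_le_pair _ _).trans (Nat.right_le_pair _ _)
    simp only [sat]
    rw [ih1 V V' a a' fun p hp k hk => h p (hp.trans h1) k (hk.trans (Nat.mul_le_mul_left _ h1)),
      ih2 V V' a a' fun p hp k hk => h p (hp.trans h2) k (hk.trans (Nat.mul_le_mul_left _ h2))]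
  | next φ ih =>
    intro V V' a a' h
    have h1 : encF φ + 1 ≤ encF (.next φ) := lt_pair_left _ _ (by norm_num)
    have h2 := Nat.mul_le_mul_left (m + 1) h1
    simp only [sat]
    apply ih
    intro p hp k hk
    have := h p (by omega) (k + 1) (by rw [mul_add] at h2; omega)
    rwa [show a + (k + 1) = a + 1 + k by ring, show a' + (k + 1) = a' + 1 + k by ring] at this
  | untl φ ψ ih1 ih2 =>
    intro V V' a a' h
    have h0 : Nat.pair (encF φ) (encF ψ) + 1 ≤ encF (.untl φ ψ) := lt_pair_left _ _ (by norm_num)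
    have h1 : encF φ + 1 ≤ encF (.untl φ ψ) :=
      (Nat.succ_le_succ (Nat.left_le_pair _ _)).trans h0
    have h2 : encF ψ + 1 ≤ encF (.untl φ ψ) :=
      (Nat.succ_le_succ (Nat.right_le_pair _ _)).trans h0
    have h3 := Nat.mul_le_mul_left (m + 1) h1
    have h4 := Nat.mul_le_mul_left (m + 1) h2
    rw [mul_add] at h3 h4
    have e1 : ∀ j ≤ m, (sat (· + m) V φ (a + j) ↔ sat (· + m) V' φ (a' + j)) := by
      intro j hj
      apply ih1
      intro p hp k hk
      have := h p (by omega) (j + k) (by omega)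
      rwa [← add_assoc, ← add_assoc] at this
    have e2 : ∀ j ≤ m, (sat (· + m) V ψ (a + j) ↔ sat (· + m) V' ψ (a' + j)) := by
      intro j hj
      apply ih2
      intro p hp k hk
      have := h p (by omega) (j + k) (by omega)
      rwa [← add_assoc, ← add_assoc] at this
    simp only [sat]
    constructor
    · rintro ⟨b, hb, hb', hs, hc⟩
      obtain ⟨j, rfl⟩ := Nat.exists_eq_add_of_le hb
      refine ⟨a' + j, by omega, by omega, (e2 j (by omega)).1 hs, ?_⟩
      intro c hc1 hc2
      obtain ⟨i, rfl⟩ := Nat.exists_eq_add_of_le hc1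
      exact (e1 i (by omega)).1 (hc _ (by omega) (by omega))
    · rintro ⟨b, hb, hb', hs, hc⟩
      obtain ⟨j, rfl⟩ := Nat.exists_eq_add_of_le hb
      refine ⟨a + j, by omega, by omega, (e2 j (by omega)).2 hs, ?_⟩
      intro c hc1 hc2
      obtain ⟨i, rfl⟩ := Nat.exists_eq_add_of_le hc1
      exact (e1 i (by omega)).2 (hc _ (by omega) (by omega))

theorem sat_subst (t : ℕ → ℕ) (V : ℕ → Set ℕ) (σ : ℕ → Fml) (φ : Fml) : ∀ a,
    sat t V (subst σ φ) a ↔ sat t (fun p => {x | sat t V (σ p) x}) φ a := by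
  induction φ with
  | letter p => intro a; simp [subst, sat]
  | bot => intro a; simp [subst, sat]
  | imp φ ψ ih1 ih2 => intro a; simp only [subst, sat, ih1, ih2]
  | next φ ih => intro a; simp only [subst, sat, ih]
  | untl φ ψ ih1 ih2 => intro a; simp only [subst, sat, ih1, ih2]

/-- Window length. -/
def Wf (m E : ℕ) : ℕ := (m + 1) * E + 1

/-- Number of windows, doubled. -/
def Pf (m E : ℕ) : ℕ := 2 * 2 ^ ((E + 1) * Wf m E)

/-- A refutation by a sequence homoclinic to a constant sequence. -/
def RefU (m : ℕ) (r : Rule) (E T : ℕ) : Prop :=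
  ∃ (V : ℕ → Set ℕ) (t : ℕ), t ≤ T ∧ (∀ p ≤ E, ∀ a < Wf m E, (a ∈ V p ↔ T ∈ V p)) ∧
    (∀ p, ∀ a, T ≤ a → (a ∈ V p ↔ T ∈ V p)) ∧
    (∀ φ ∈ r.prem, ∀ a, sat (· + m) V φ a) ∧ ¬ sat (· + m) V r.concl t

theorem encF_le_encL (l : List Fml) : ∀ φ ∈ l, encF φ ≤ encL l := by
  induction l with
  | nil => simp
  | cons ψ l ih =>
    intro φ h
    have h1 := Nat.left_le_pair (encF ψ) (encL l)
    have h2 := Nat.right_le_pair (encF ψ) (encL l)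
    simp only [encL]
    rcases List.mem_cons.1 h with rfl | h
    · omega
    · have := ih φ h
      omega

theorem prem_le (r : Rule) : ∀ φ ∈ r.prem, encF φ ≤ encRule r := fun φ h =>
  (encF_le_encL _ φ h).trans (Nat.left_le_pair _ _)

theorem concl_le (r : Rule) : encF r.concl ≤ encRule r := Nat.right_le_pair _ _

/-- locality in terms of windows -/
theorem locW (m E : ℕ) (φ : Fml) (hφ : encF φ ≤ E) (V V' : ℕ → Set ℕ) (a a' : ℕ)
    (h : ∀ p ≤ E, ∀ k < Wf m E, (a + k ∈ V p ↔ a' + k ∈ V' p)) :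
    (sat (· + m) V φ a ↔ sat (· + m) V' φ a') := by
  apply loc
  intro p hp k hk
  have := Nat.mul_le_mul_left (m + 1) hφ
  exact h p (hp.trans hφ) k (by unfold Wf; omega)

theorem RefU.mono {m : ℕ} {r : Rule} {E T T' : ℕ} (hT : T ≤ T') (h : RefU m r E T) :
    RefU m r E T' := by
  obtain ⟨V, t, h1, h2, h3, h4, h5⟩ := h
  refine ⟨V, t, h1.trans hT, ?_, ?_, h4, h5⟩
  · intro p hp a ha
    rw [h3 p T' hT]; exact h2 p hp a ha
  · intro p a ha
    rw [h3 p T' hT]; exact h3 p a (hT.trans ha)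

theorem refU_of_not_adm (m : ℕ) (r : Rule) (h : ¬ Admissible (LTLNTm m) r) :
    ∃ T, RefU m r (encRule r) T := by
  unfold Admissible at h
  push Not at h
  obtain ⟨σ, hprem, hc⟩ := h
  simp only [LTLNTm, Set.mem_ofPred_eq] at hprem hc
  push Not at hc
  obtain ⟨V0, a0, hc⟩ := hc
  set E := encRule r with hE
  obtain ⟨H, hH⟩ : ∃ H, ∀ p ≤ E, (m + 1) * encF (σ p) ≤ H := by
    refine ⟨∑ p ∈ Finset.range (E + 1), (m + 1) * encF (σ p), fun p hp => ?_⟩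
    exact Finset.single_le_sum (f := fun p => (m + 1) * encF (σ p)) (fun _ _ => Nat.zero_le _)
      (Finset.mem_range.2 (by omega))
  set W := Wf m E with hW
  let K := W + H
  let V1 : ℕ → Set ℕ := fun p => {x | K ≤ x ∧ x ≤ K + K ∧ (x - K + a0) ∈ V0 p}
  let V : ℕ → Set ℕ := fun p => {a | p ≤ E ∧ sat (· + m) V1 (σ p) a}
  have hconst : ∀ p, ∀ a, (a < W ∨ K + K + 1 ≤ a) → (a ∈ V p ↔ K + K + 1 ∈ V p) := by
    intro p a ha
    simp only [V, Set.mem_ofPred_eq]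
    refine and_congr_right fun hp => ?_
    apply loc
    intro q hq k hk
    have := hH p hp
    have e1 : ¬ (a + k ∈ V1 q) := by
      rintro ⟨h1, h2, -⟩
      dsimp only [K] at *
      omega
    have e2 : ¬ (K + K + 1 + k ∈ V1 q) := by
      rintro ⟨h1, h2, -⟩
      omega
    simp [e1, e2]
  refine ⟨K + K + 1, V, K, by omega, fun p _ a ha => hconst p a (Or.inl ha),
    fun p a ha => hconst p a (Or.inr ha), ?_, ?_⟩
  · intro φ hφ a
    have := hprem φ hφ V1 a
    rw [sat_subst] at this
    refine (locW m E φ (prem_le r φ hφ) _ _ a a ?_).1 this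
    intro p hp k hk
    simp [V, hp]
  · intro hs
    apply hc
    rw [sat_subst]
    refine (locW m E r.concl (concl_le r) _ _ K a0 ?_).1 hs
    intro p hp k hk
    simp only [V, Set.mem_ofPred_eq, hp, true_and]
    apply loc
    intro q hq j hj
    have := hH p hp
    simp only [V1, Set.mem_ofPred_eq]
    rw [show K + k + j - K + a0 = a0 + k + j by omega]
    constructor
    · rintro ⟨_, _, h⟩; exact h
    · intro h
      refine ⟨by omega, ?_, h⟩
      dsimp only [K] at *
      omega

theorem cut {m : ℕ} {r : Rule} {T i j t : ℕ} (V : ℕ → Set ℕ) (ht : t ≤ T)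
    (hij : i < j) (hjT : j ≤ T) (htij : t ≤ i ∨ j ≤ t)
    (h2 : ∀ p ≤ encRule r, ∀ a < Wf m (encRule r), (a ∈ V p ↔ T ∈ V p))
    (h3 : ∀ p, ∀ a, T ≤ a → (a ∈ V p ↔ T ∈ V p))
    (h4 : ∀ φ ∈ r.prem, ∀ a, sat (· + m) V φ a) (h5 : ¬ sat (· + m) V r.concl t)
    (hw : ∀ p ≤ encRule r, ∀ k < Wf m (encRule r), (i + k ∈ V p ↔ j + k ∈ V p)) :
    RefU m r (encRule r) (T - (j - i)) := by
  let V' : ℕ → Set ℕ := fun p => {x | if x < i then x ∈ V p else x + (j - i) ∈ V p}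
  have e1 : ∀ a ≤ i, ∀ p ≤ encRule r, ∀ k < Wf m (encRule r), (a + k ∈ V' p ↔ a + k ∈ V p) := by
    intro a ha p hp k hk
    simp only [V', Set.mem_ofPred_eq]
    split_ifs with h
    · rfl
    · obtain ⟨d, hd⟩ := Nat.exists_eq_add_of_le (not_lt.1 h)
      rw [hd, hw p hp d (by omega)]
      rw [show i + d + (j - i) = j + d by omega]
  have e2 : ∀ a, i ≤ a → ∀ p, (a ∈ V' p ↔ a + (j - i) ∈ V p) := by
    intro a ha p
    simp only [V', Set.mem_ofPred_eq, if_neg (not_lt.2 ha)]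
  have e3 : ∀ a, i ≤ a → ∀ p ≤ encRule r, ∀ k < Wf m (encRule r),
      (a + k ∈ V' p ↔ (a + (j - i)) + k ∈ V p) := by
    intro a ha p hp k hk
    rw [e2 _ (by omega), show a + k + (j - i) = a + (j - i) + k by omega]
  have eT : ∀ p, (T - (j - i) ∈ V' p ↔ T ∈ V p) := by
    intro p
    rw [e2 _ (by omega), show T - (j - i) + (j - i) = T by omega]
  have hex : ∃ t' ≤ T - (j - i), ¬ sat (· + m) V' r.concl t' := by
    rcases htij with h | h
    · exact ⟨t, by omega, by rwa [locW m _ _ (concl_le r) V' V t t (e1 t h)]⟩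
    · refine ⟨t - (j - i), by omega, ?_⟩
      rw [locW m _ _ (concl_le r) V' V _ _ (e3 (t - (j - i)) (by omega))]
      rwa [show t - (j - i) + (j - i) = t by omega]
  obtain ⟨t', ht', hs'⟩ := hex
  refine ⟨V', t', ht', ?_, ?_, ?_, hs'⟩
  · intro p hp a ha
    have := e1 0 (Nat.zero_le _) p hp a ha
    rw [zero_add] at this
    rw [this, eT]
    exact h2 p hp a ha
  · intro p a ha
    rw [eT, e2 _ (by omega)]
    exact h3 p _ (by omega)
  · intro φ hφ a
    rcases le_total a i with h | h
    · rw [locW m _ _ (prem_le r φ hφ) V' V _ _ (e1 a h)]; exact h4 φ hφ _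
    · rw [locW m _ _ (prem_le r φ hφ) V' V _ _ (e3 a h)]; exact h4 φ hφ _

theorem pigeon (m E : ℕ) (V : ℕ → Set ℕ) (s : ℕ) : ∃ i j, s ≤ i ∧ i < j ∧
    j ≤ s + 2 ^ ((E + 1) * Wf m E) ∧
    ∀ p ≤ E, ∀ k < Wf m E, (i + k ∈ V p ↔ j + k ∈ V p) := by
  classical
  let F : Fin (2 ^ ((E + 1) * Wf m E) + 1) → (Fin (E + 1) × Fin (Wf m E) → Bool) :=
    fun x q => decide (s + x.1 + q.2.1 ∈ V q.1.1)
  obtain ⟨x, y, hxy, hF⟩ := Fintype.exists_ne_map_eq_of_card_lt F (by simp)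
  have key : ∀ x y : Fin (2 ^ ((E + 1) * Wf m E) + 1), x.1 < y.1 → F x = F y → ∃ i j, s ≤ i ∧ i < j ∧
    j ≤ s + 2 ^ ((E + 1) * Wf m E) ∧
    ∀ p ≤ E, ∀ k < Wf m E, (i + k ∈ V p ↔ j + k ∈ V p) := by
    intro x y hxy hF
    refine ⟨s + x.1, s + y.1, by omega, by omega, by omega, ?_⟩
    intro p hp k hk
    have := congrFun hF (⟨p, by omega⟩, ⟨k, hk⟩)
    simpa [F] using this
  rcases lt_trichotomy x.1 y.1 with h | h | h
  · exact key x y h hF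
  · exact absurd (Fin.ext h) hxy
  · exact key y x h hF.symm

theorem bound (m : ℕ) (r : Rule) : ∀ T, RefU m r (encRule r) T →
    RefU m r (encRule r) (Pf m (encRule r)) := by
  intro T
  induction T using Nat.strong_induction_on with
  | _ T ih =>
    intro h
    by_cases hT : T ≤ Pf m (encRule r)
    · exact h.mono hT
    obtain ⟨V, t, h1, h2, h3, h4, h5⟩ := h
    unfold Pf at hT
    by_cases htc : 2 ^ ((encRule r + 1) * Wf m (encRule r)) ≤ t
    · obtain ⟨i, j, hi, hij, hj, hw⟩ := pigeon m (encRule r) V 0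
      exact ih (T - (j - i)) (by omega)
        (cut V h1 hij (by omega) (Or.inr (by omega)) h2 h3 h4 h5 hw)
    · obtain ⟨i, j, hi, hij, hj, hw⟩ := pigeon m (encRule r) V t
      exact ih (T - (j - i)) (by omega)
        (cut V h1 hij (by omega) (Or.inl (by omega)) h2 h3 h4 h5 hw)

section semantics
variable (t : ℕ → ℕ) (V : ℕ → Set ℕ)

theorem sat_neg (φ : Fml) (a : ℕ) : sat t V φ.neg a ↔ ¬ sat t V φ a := by
  simp [Fml.neg, sat]

theorem sat_conj (φ ψ : Fml) (a : ℕ) : sat t V (φ.conj ψ) a ↔ sat t V φ a ∧ sat t V ψ a := by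
  simp [Fml.conj, Fml.neg, sat]

theorem sat_disj (φ ψ : Fml) (a : ℕ) : sat t V (φ.disj ψ) a ↔ sat t V φ a ∨ sat t V ψ a := by
  simp only [Fml.disj, Fml.neg, sat]; tauto

theorem sat_bigConj (l : List Fml) (a : ℕ) : sat t V (bigConj l) a ↔ ∀ φ ∈ l, sat t V φ a := by
  induction l with
  | nil => simp [bigConj, Fml.top, Fml.neg, sat]
  | cons φ l ih => simp [bigConj, sat_conj, ih, and_comm]

theorem sat_bigDisj (l : List Fml) (a : ℕ) : sat t V (bigDisj l) a ↔ ∃ φ ∈ l, sat t V φ a := by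
  induction l with
  | nil => simp [bigDisj, sat]
  | cons φ l ih => simp [bigDisj, sat_disj, ih, or_comm]

theorem sat_nPow (k : ℕ) (φ : Fml) : ∀ a, sat t V (nPow k φ) a ↔ sat t V φ (a + k) := by
  induction k with
  | zero => intro a; simp [nPow]
  | succ k ih => intro a; simp [nPow, sat, ih, add_assoc, add_comm 1 k]

end semantics

/-- the marker event formula -/
def evF (L : ℕ) : Fml :=
  (Fml.letter 0).conj (bigConj ((List.range L).map fun k => (nPow (k + 1) (.letter 0)).neg))

theorem sat_evF (t : ℕ → ℕ) (X : ℕ → Set ℕ) (L a : ℕ) :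
    sat t X (evF L) a ↔ (a ∈ X 0 ∧ ∀ k < L, a + (k + 1) ∉ X 0) := by
  simp [evF, sat_conj, sat_bigConj, sat_neg, sat_nPow, sat]

open Classical in
/-- the substitution built from a refuting sequence -/
noncomputable def sigma (L : ℕ) (V : ℕ → Set ℕ) (p : ℕ) : Fml :=
  (bigDisj ((List.range L).map fun d => if L - 1 - d ∈ V p then nPow d (evF L) else .bot)).disj
    (if L ∈ V p then (bigDisj ((List.range L).map fun d => nPow d (evF L))).neg else .bot)

theorem sat_sigma (t : ℕ → ℕ) (X : ℕ → Set ℕ) (L : ℕ) (V : ℕ → Set ℕ) (p a : ℕ) :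
    sat t X (sigma L V p) a ↔ (∃ d < L, L - 1 - d ∈ V p ∧ sat t X (evF L) (a + d)) ∨
      (L ∈ V p ∧ ∀ d < L, ¬ sat t X (evF L) (a + d)) := by
  classical
  have e1 : ∀ d, sat t X (if L - 1 - d ∈ V p then nPow d (evF L) else .bot) a ↔
      (L - 1 - d ∈ V p ∧ sat t X (evF L) (a + d)) := by
    intro d
    split_ifs with h
    · simp [h, sat_nPow]
    · simp [h, sat]
  unfold sigma
  rw [sat_disj, sat_bigDisj]
  apply or_congr
  · simp [e1]
  · split_ifs with h
    · simp [h, sat_neg, sat_bigDisj, sat_nPow]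
    · simp [h, sat]

theorem not_adm_of_refU (m : ℕ) (r : Rule) (T : ℕ) (h : RefU m r (encRule r) T) :
    ¬ Admissible (LTLNTm m) r := by
  obtain ⟨V, t, h1, h2, h3, h4, h5⟩ := h
  intro hadm
  have key := hadm (sigma T V) ?_
  · -- the conclusion
    apply h5
    have := key (fun _ => {T - 1}) t
    rw [sat_subst] at this
    refine (locW m _ _ (concl_le r) _ _ t t ?_).1 this
    intro p hp k hk
    generalize t + k = a
    simp only [Set.mem_ofPred_eq]
    rw [sat_sigma]
    have hev : ∀ b, sat (· + m) (fun _ => {T - 1}) (evF T) b ↔ b = T - 1 := by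
      intro b
      rw [sat_evF]
      simp only [Set.mem_singleton_iff]
      constructor
      · exact fun h => h.1
      · intro h; exact ⟨h, fun k hk => by omega⟩
    simp only [hev]
    by_cases ha : a < T
    · constructor
      · rintro (⟨d, hd, hv, he⟩ | ⟨_, hn⟩)
        · rwa [show a = T - 1 - d by omega]
        · exact absurd (show a + (T - 1 - a) = T - 1 by omega) (hn (T - 1 - a) (by omega))
      · intro hv
        left
        exact ⟨T - 1 - a, by omega, by rwa [show T - 1 - (T - 1 - a) = a by omega], by omega⟩
    · rw [h3 p a (by omega)]
      constructor
      · rintro (⟨d, hd, hv, he⟩ | ⟨hv, hn⟩)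
        · omega
        · exact hv
      · intro hv
        exact Or.inr ⟨hv, fun d hd => by omega⟩
  · intro φ hφ X i
    rw [sat_subst]
    set Ev : ℕ → Prop := fun j => sat (· + m) X (evF T) j with hEv
    have sep : ∀ j j', Ev j → Ev j' → j < j' → j + T < j' := by
      intro j j' hj hj' hlt
      by_contra hcon
      have a1 := (sat_evF _ _ _ _).1 hj
      have a2 := (sat_evF _ _ _ _).1 hj'
      apply a1.2 (j' - j - 1) (by omega)
      rw [show j + (j' - j - 1 + 1) = j' by omega]
      exact a2.1
    have hsig : ∀ p a, sat (· + m) X (sigma T V p) a ↔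
      (∃ d < T, T - 1 - d ∈ V p ∧ Ev (a + d)) ∨ (T ∈ V p ∧ ∀ d < T, ¬ Ev (a + d)) :=
      fun p a => sat_sigma _ _ _ _ _ _
    -- value outside blocks
    have hout : ∀ p ≤ encRule r, ∀ a, (∀ d < T, Ev (a + d) → T - 1 - d < Wf m (encRule r)) →
        (sat (· + m) X (sigma T V p) a ↔ T ∈ V p) := by
      intro p hp a hd
      rw [hsig]
      constructor
      · rintro (⟨d, hd1, hv, he⟩ | ⟨hv, _⟩)
        · exact (h2 p hp _ (hd d hd1 he)).1 hv
        · exact hv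
      · intro hv
        by_cases hex : ∃ d < T, Ev (a + d)
        · obtain ⟨d, hd1, he⟩ := hex
          exact Or.inl ⟨d, hd1, (h2 p hp _ (hd d hd1 he)).2 hv, he⟩
        · push Not at hex
          exact Or.inr ⟨hv, hex⟩
    have hwin : ∃ k, ∀ p ≤ encRule r, ∀ w < Wf m (encRule r),
        (sat (· + m) X (sigma T V p) (i + w) ↔ k + w ∈ V p) := by
      by_cases hex : ∃ d < T, Ev (i + d)
      · obtain ⟨d, hd, he⟩ := hex
        refine ⟨T - 1 - d, fun p hp w hw => ?_⟩
        by_cases hwd : w ≤ d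
        · rw [hsig]
          constructor
          · rintro (⟨d', hd', hv, he'⟩ | ⟨_, hn⟩)
            · have : i + w + d' = i + d := by
                rcases lt_trichotomy (i + w + d') (i + d) with h | h | h
                · have := sep _ _ he' he h; omega
                · exact h
                · have := sep _ _ he he' h; omega
              rwa [show T - 1 - d + w = T - 1 - d' by omega]
            · exact absurd (show Ev (i + w + (d - w)) by
                rwa [show i + w + (d - w) = i + d by omega]) (hn (d - w) (by omega))
          · intro hv
            refine Or.inl ⟨d - w, by omega, ?_, ?_⟩
            · rwa [show T - 1 - (d - w) = T - 1 - d + w by omega]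
            · rwa [show i + w + (d - w) = i + d by omega]
        · rw [h3 p _ (by omega)]
          apply hout p hp
          intro d' hd' he'
          have := sep _ _ he he' (by omega)
          omega
      · push Not at hex
        refine ⟨T, fun p hp w hw => ?_⟩
        rw [h3 p _ (by omega)]
        apply hout p hp
        intro d' hd' he'
        by_contra hcon
        exact hex (w + d') (by omega) (by rwa [← add_assoc])
    obtain ⟨k, hk⟩ := hwin
    refine (locW m _ _ (prem_le r φ hφ) _ V i k ?_).2 (h4 φ hφ k)
    intro p hp w hw
    exact hk p hp w hw

theorem adm_iff (m : ℕ) (r : Rule) :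
    ¬ Admissible (LTLNTm m) r ↔ RefU m r (encRule r) (Pf m (encRule r)) :=
  ⟨fun h => let ⟨T, hT⟩ := refU_of_not_adm m r h; bound m r T hT, not_adm_of_refU m r _⟩

/-- A total decoder of formula codes. -/
def dec (n : ℕ) : Fml :=
  if n.unpair.1 = 0 then .letter n.unpair.2
  else if _ : n.unpair.1 = 1 then .bot
  else if _ : n.unpair.1 = 2 then .imp (dec n.unpair.2.unpair.1) (dec n.unpair.2.unpair.2)
  else if _ : n.unpair.1 = 3 then .next (dec n.unpair.2)
  else if _ : n.unpair.1 = 4 then .untl (dec n.unpair.2.unpair.1) (dec n.unpair.2.unpair.2)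
  else .bot
termination_by n
decreasing_by
  all_goals
    have h1 := Nat.unpair_left_le n.unpair.2
    have h2 := Nat.unpair_right_le n.unpair.2
    have h3 := Nat.add_le_pair n.unpair.1 n.unpair.2
    rw [Nat.pair_unpair] at h3
    omega

theorem dec_encF (φ : Fml) : dec (encF φ) = φ := by
  induction φ with
  | letter p => rw [dec]; simp [encF]
  | bot => rw [dec]; simp [encF]
  | imp φ ψ h1 h2 => rw [dec]; simp [encF, h1, h2]
  | next φ h => rw [dec]; simp [encF, h]
  | untl φ ψ h1 h2 => rw [dec]; simp [encF, h1, h2]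

/-- Table bit: the formula with code `n` at the (clamped) position `a`. -/
def B (P s n a : ℕ) : Prop := s / 2 ^ (n * (P + 1) + min a P) % 2 = 1

theorem B_clamp (P s n a : ℕ) : B P s n (min a P) ↔ B P s n a := by
  unfold B; simp

/-- Local consistency of the table. -/
def Clause (m W P s n a : ℕ) : Prop :=
  (¬ n.unpair.1 = 0 ∨ ¬ a < W ∨ ((B P s n a ∧ B P s n P) ∨ (¬ B P s n a ∧ ¬ B P s n P))) ∧
  (¬ n.unpair.1 = 1 ∨ ¬ B P s n a) ∧
  (¬ n.unpair.1 = 2 ∨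
    ((B P s n a ∧ (¬ B P s n.unpair.2.unpair.1 a ∨ B P s n.unpair.2.unpair.2 a)) ∨
    (¬ B P s n a ∧ ¬ (¬ B P s n.unpair.2.unpair.1 a ∨ B P s n.unpair.2.unpair.2 a)))) ∧
  (¬ n.unpair.1 = 3 ∨
    ((B P s n a ∧ B P s n.unpair.2 (a + 1)) ∨ (¬ B P s n a ∧ ¬ B P s n.unpair.2 (a + 1)))) ∧
  (¬ n.unpair.1 = 4 ∨
    ((B P s n a ∧ (∃ k < m + 1, B P s n.unpair.2.unpair.2 (a + k) ∧
        ∀ j < k, B P s n.unpair.2.unpair.1 (a + j))) ∨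
     (¬ B P s n a ∧ ¬ (∃ k < m + 1, B P s n.unpair.2.unpair.2 (a + k) ∧
        ∀ j < k, B P s n.unpair.2.unpair.1 (a + j)))))

/-- Tail of a list code. -/
def tl (l : ℕ) : ℕ := (l - 1).unpair.2

/-- The bounded search. -/
def Ref (m e : ℕ) : Prop :=
  ∃ s < 2 ^ ((e + 1) * (Pf m e + 1)),
    (∀ n < e + 1, ∀ a < Pf m e + 1, Clause m (Wf m e) (Pf m e) s n a) ∧
    (∀ k < e + 1, tl^[k] e.unpair.1 = 0 ∨
      ∀ a < Pf m e + 1, B (Pf m e) s (tl^[k] e.unpair.1 - 1).unpair.1 a) ∧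
    ∃ a < Pf m e + 1, ¬ B (Pf m e) s e.unpair.2 a

theorem list_forall (Q : ℕ → Prop) (l : List Fml) : ∀ N, encL l ≤ N →
    ((∀ k < N + 1, tl^[k] (encL l) = 0 ∨ Q (tl^[k] (encL l) - 1).unpair.1) ↔
      ∀ φ ∈ l, Q (encF φ)) := by
  induction l with
  | nil =>
    intro N _
    have : ∀ k, tl^[k] 0 = 0 := by
      intro k
      induction k with
      | zero => rfl
      | succ k ih => rw [Function.iterate_succ_apply]; simpa [tl] using ih
    simp [encL, this]
  | cons φ l ih =>
    intro N hN
    have hr := Nat.right_le_pair (encF φ) (encL l)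
    simp only [encL] at hN ⊢
    have htl : tl (Nat.pair (encF φ) (encL l) + 1) = encL l := by simp [tl]
    obtain ⟨N, rfl⟩ : ∃ M, N = M + 1 := ⟨N - 1, by omega⟩
    have ih' := ih N (by omega)
    simp only [List.mem_cons, forall_eq_or_imp]
    rw [← ih']
    constructor
    · intro h
      constructor
      · simpa using h 0 (by omega)
      · intro k hk
        have := h (k + 1) (by omega)
        rwa [Function.iterate_succ_apply, htl] at this
    · rintro ⟨h0, h⟩ k hk
      cases k with
      | zero => right; simpa using h0
      | succ k => rw [Function.iterate_succ_apply, htl]; exact h k (by omega)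

theorem sat_clamp (m P : ℕ) (V : ℕ → Set ℕ) (hV : ∀ p, ∀ a, P ≤ a → (a ∈ V p ↔ P ∈ V p))
    (φ : Fml) (a : ℕ) : sat (· + m) V φ (min a P) ↔ sat (· + m) V φ a := by
  rcases le_total a P with h | h
  · rw [min_eq_left h]
  · rw [min_eq_right h]
    apply loc
    intro p _ k _
    rw [hV p (P + k) (by omega), hV p (a + k) (by omega)]

theorem untl_iff (m : ℕ) (V : ℕ → Set ℕ) (φ ψ : Fml) (a : ℕ) :
    sat (· + m) V (.untl φ ψ) a ↔ ∃ k < m + 1, sat (· + m) V ψ (a + k) ∧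
      ∀ j < k, sat (· + m) V φ (a + j) := by
  simp only [sat]
  constructor
  · rintro ⟨b, hb, hb', hs, hc⟩
    obtain ⟨j, rfl⟩ := Nat.exists_eq_add_of_le hb
    exact ⟨j, by omega, hs, fun i hi => hc _ (by omega) (by omega)⟩
  · rintro ⟨k, hk, hs, hc⟩
    refine ⟨a + k, by omega, by omega, hs, fun c h1 h2 => ?_⟩
    obtain ⟨i, rfl⟩ := Nat.exists_eq_add_of_le h1
    exact hc i (by omega)

theorem exists_table (P E : ℕ) (Q : ℕ → ℕ → Prop) : ∃ s < 2 ^ ((E + 1) * (P + 1)),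
    ∀ n ≤ E, ∀ a, (B P s n a ↔ Q n (min a P)) := by
  classical
  refine ⟨Nat.ofBits (n := (E + 1) * (P + 1))
    fun i => decide (Q (i.1 / (P + 1)) (i.1 % (P + 1))), Nat.ofBits_lt_two_pow _, ?_⟩
  intro n hn a
  have hlt : n * (P + 1) + min a P < (E + 1) * (P + 1) := by
    have h1 : n * (P + 1) ≤ E * (P + 1) := Nat.mul_le_mul_right _ hn
    have h2 : min a P ≤ P := min_le_right _ _
    rw [add_mul E 1]
    omega
  have h3 := Nat.testBit_ofBits_lt
    (fun i : Fin ((E + 1) * (P + 1)) => decide (Q (i.1 / (P + 1)) (i.1 % (P + 1)))) _ hlt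
  have hm : min a P < P + 1 := by have := min_le_right a P; omega
  have h4 : (n * (P + 1) + min a P) / (P + 1) = n := by
    rw [mul_comm, Nat.mul_add_div (by omega), Nat.div_eq_of_lt hm]; rfl
  have h5 : (n * (P + 1) + min a P) % (P + 1) = min a P := by
    rw [mul_comm, Nat.mul_add_mod, Nat.mod_eq_of_lt hm]
  rw [Nat.testBit_eq_decide_div_mod_eq] at h3
  simp only [h4, h5] at h3
  unfold B
  exact decide_eq_decide.1 h3

theorem iff_of_cases {p q : Prop} (h : (p ∧ q) ∨ (¬ p ∧ ¬ q)) : q ↔ p := by tauto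

theorem refU_of_ref (m : ℕ) (r : Rule) (h : Ref m (encRule r)) :
    RefU m r (encRule r) (Pf m (encRule r)) := by
  obtain ⟨s, -, hcl, hprem, t, ht, hc⟩ := h
  set E := encRule r with hE
  set P := Pf m E with hP
  let V : ℕ → Set ℕ := fun p => {a | Nat.pair 0 p ≤ E ∧ B P s (Nat.pair 0 p) a}
  have hV : ∀ p, ∀ a, P ≤ a → (a ∈ V p ↔ P ∈ V p) := by
    intro p a ha
    simp only [V, Set.mem_ofPred_eq]
    rw [← B_clamp P s _ a, min_eq_right ha]
  have key : ∀ φ, encF φ ≤ E → ∀ a, (sat (· + m) V φ a ↔ B P s (encF φ) a) := by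
    intro φ
    induction φ with
    | letter p =>
      intro hle a
      simp only [encF] at hle ⊢
      simp [sat, V, hle]
    | bot =>
      intro hle a
      simp only [sat, false_iff]
      rw [← B_clamp]
      have := (hcl _ (Nat.lt_succ_of_le hle) (min a P) (by have := min_le_right a P; omega)).2.1
      simpa [encF] using this
    | imp φ ψ h1 h2 =>
      intro hle a
      rw [← B_clamp, ← sat_clamp m P V hV]
      have := (hcl _ (Nat.lt_succ_of_le hle) (min a P) (by have := min_le_right a P; omega)).2.2.1
      have i1 : encF φ ≤ encF (.imp φ ψ) :=
        (Nat.left_le_pair _ _).trans (Nat.right_le_pair _ _)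
      have i2 : encF ψ ≤ encF (.imp φ ψ) :=
        (Nat.right_le_pair _ _).trans (Nat.right_le_pair _ _)
      simp only [sat]
      rw [h1 (i1.trans hle), h2 (i2.trans hle)]
      simp only [encF, Nat.unpair_pair, not_true_eq_false, false_or] at this ⊢
      rw [← imp_iff_not_or] at this
      exact iff_of_cases this
    | next φ h1 =>
      intro hle a
      rw [← B_clamp, ← sat_clamp m P V hV]
      have := (hcl _ (Nat.lt_succ_of_le hle) (min a P)
        (by have := min_le_right a P; omega)).2.2.2.1
      have i1 : encF φ ≤ encF (.next φ) := Nat.right_le_pair _ _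
      simp only [sat]
      rw [h1 (i1.trans hle)]
      simp only [encF, Nat.unpair_pair, not_true_eq_false, false_or] at this ⊢
      exact iff_of_cases this
    | untl φ ψ h1 h2 =>
      intro hle a
      rw [← B_clamp, ← sat_clamp m P V hV]
      have := (hcl _ (Nat.lt_succ_of_le hle) (min a P)
        (by have := min_le_right a P; omega)).2.2.2.2
      have i1 : encF φ ≤ encF (.untl φ ψ) :=
        (Nat.left_le_pair _ _).trans (Nat.right_le_pair _ _)
      have i2 : encF ψ ≤ encF (.untl φ ψ) :=
        (Nat.right_le_pair _ _).trans (Nat.right_le_pair _ _)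
      rw [untl_iff]
      simp only [h1 (i1.trans hle), h2 (i2.trans hle)]
      simp only [encF, Nat.unpair_pair, not_true_eq_false, false_or] at this ⊢
      exact iff_of_cases this
  refine ⟨V, t, by omega, ?_, hV, ?_, ?_⟩
  · intro p hp a ha
    simp only [V, Set.mem_ofPred_eq]
    refine and_congr_right fun hle => ?_
    by_cases haP : a ≤ P
    · have := (hcl _ (Nat.lt_succ_of_le hle) a (by omega)).1
      simp only [Nat.unpair_pair, not_true_eq_false, false_or] at this
      rcases this with h | h
      · exact absurd ha h
      · exact (iff_of_cases h).symm
    · rw [← B_clamp P s _ a, min_eq_right (by omega)]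
  · have h0 : E.unpair.1 = encL r.prem := by simp [hE, encRule]
    rw [h0] at hprem
    have := (list_forall (fun n => ∀ a < P + 1, B P s n a) r.prem E
      (Nat.left_le_pair _ _)).1 hprem
    intro φ hφ a
    rw [key φ (prem_le r φ hφ), ← B_clamp]
    exact this φ hφ _ (by have := min_le_right a P; omega)
  · rw [key _ (concl_le r)]
    have h0 : E.unpair.2 = encF r.concl := by simp [hE, encRule]
    rwa [h0] at hc

theorem cases_of_iff {p q : Prop} (h : p ↔ q) : (p ∧ q) ∨ (¬ p ∧ ¬ q) := by tauto

theorem ref_of_refU (m : ℕ) (r : Rule) (h : RefU m r (encRule r) (Pf m (encRule r))) :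
    Ref m (encRule r) := by
  obtain ⟨V, t, h1, h2, hV, h4, h5⟩ := h
  set E := encRule r with hE
  set P := Pf m E with hP
  obtain ⟨s, hs, hB⟩ := exists_table P E fun n a => sat (· + m) V (dec n) a
  have hB' : ∀ n ≤ E, ∀ a, (B P s n a ↔ sat (· + m) V (dec n) a) := by
    intro n hn a
    rw [hB n hn, sat_clamp m P V hV]
  refine ⟨s, hs, ?_, ?_, t, by omega, ?_⟩
  · intro n hn a ha
    have hn2 := Nat.unpair_right_le n
    have hn21 := Nat.unpair_left_le n.unpair.2
    have hn22 := Nat.unpair_right_le n.unpair.2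
    have a0 := hB' n (by omega)
    have a1 := hB' n.unpair.2 (by omega)
    have a2 := hB' n.unpair.2.unpair.1 (by omega)
    have a3 := hB' n.unpair.2.unpair.2 (by omega)
    change Clause m (Wf m E) P s n a
    unfold Clause
    simp only [a0, a1, a2, a3]
    refine ⟨?_, ?_, ?_, ?_, ?_⟩
    · by_cases h : n.unpair.1 = 0
      · by_cases hw : a < Wf m E
        · have e : dec n = .letter n.unpair.2 := by rw [dec]; simp [h]
          have := h2 n.unpair.2 (by omega) a hw
          simp only [e, sat]
          exact Or.inr (Or.inr (cases_of_iff this))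
        · exact Or.inr (Or.inl hw)
      · exact Or.inl h
    · by_cases h : n.unpair.1 = 1
      · have e : dec n = .bot := by rw [dec]; simp [h]
        simp [e, sat]
      · exact Or.inl h
    · by_cases h : n.unpair.1 = 2
      · have e : dec n = .imp (dec n.unpair.2.unpair.1) (dec n.unpair.2.unpair.2) := by
          rw [dec]; simp [h]
        rw [e]
        exact Or.inr (cases_of_iff imp_iff_not_or)
      · exact Or.inl h
    · by_cases h : n.unpair.1 = 3
      · have e : dec n = .next (dec n.unpair.2) := by
          rw [dec]; simp [h]
        rw [e]
        simp only [sat]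
        exact Or.inr (cases_of_iff Iff.rfl)
      · exact Or.inl h
    · by_cases h : n.unpair.1 = 4
      · have e : dec n = .untl (dec n.unpair.2.unpair.1) (dec n.unpair.2.unpair.2) := by
          rw [dec]; simp [h]
        rw [e, untl_iff]
        exact Or.inr (cases_of_iff Iff.rfl)
      · exact Or.inl h
  · have h0 : E.unpair.1 = encL r.prem := by simp [hE, encRule]
    rw [h0]
    refine (list_forall (fun n => ∀ a < P + 1, B P s n a) r.prem E
      (Nat.left_le_pair _ _)).2 ?_
    intro φ hφ a _
    rw [hB' _ (prem_le r φ hφ), dec_encF]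
    exact h4 φ hφ a
  · have h0 : E.unpair.2 = encF r.concl := by simp [hE, encRule]
    rw [h0, hB' _ (concl_le r), dec_encF]
    exact h5

section prim
variable {α : Type} [Primcodable α]
open Primrec

theorem p_ex {f : α → ℕ} {R : ℕ → α → Prop} (hf : Primrec f)
    (hR : PrimrecPred fun q : ℕ × α => R q.1 q.2) : PrimrecPred fun y => ∃ x < f y, R x y := by
  have h : PrimrecRel R := hR
  exact (h.exists_mem_list.comp (list_range.comp hf) Primrec.id).of_eq (by simp)

theorem p_all {f : α → ℕ} {R : ℕ → α → Prop} (hf : Primrec f)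
    (hR : PrimrecPred fun q : ℕ × α => R q.1 q.2) : PrimrecPred fun y => ∀ x < f y, R x y := by
  have h : PrimrecRel R := hR
  exact (h.forall_mem_list.comp (list_range.comp hf) Primrec.id).of_eq (by simp)

theorem p_pow2 {f : α → ℕ} (hf : Primrec f) : Primrec fun x => 2 ^ f x := by
  have : Primrec₂ ((· ^ ·) : ℕ → ℕ → ℕ) := Primrec₂.unpaired'.1 Nat.Primrec.pow
  exact this.comp (const 2) hf

theorem p_u1 {f : α → ℕ} (hf : Primrec f) : Primrec fun x => (f x).unpair.1 :=
  fst.comp (unpair.comp hf)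

theorem p_u2 {f : α → ℕ} (hf : Primrec f) : Primrec fun x => (f x).unpair.2 :=
  snd.comp (unpair.comp hf)

theorem p_add {f g : α → ℕ} (hf : Primrec f) (hg : Primrec g) : Primrec fun x => f x + g x :=
  nat_add.comp hf hg

theorem p_mul {f g : α → ℕ} (hf : Primrec f) (hg : Primrec g) : Primrec fun x => f x * g x :=
  nat_mul.comp hf hg

theorem p_Wf (m : ℕ) {f : α → ℕ} (hf : Primrec f) : Primrec fun x => Wf m (f x) := by
  unfold Wf
  exact p_add (p_mul (const _) hf) (const 1)

theorem p_Pf (m : ℕ) {f : α → ℕ} (hf : Primrec f) : Primrec fun x => Pf m (f x) := by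
  unfold Pf
  exact p_mul (const 2) (p_pow2 (p_mul (p_add hf (const 1)) (p_Wf m hf)))

theorem p_B {P s n a : α → ℕ} (hP : Primrec P) (hs : Primrec s) (hn : Primrec n)
    (ha : Primrec a) : PrimrecPred fun x => B (P x) (s x) (n x) (a x) := by
  unfold B
  refine Primrec.eq.comp (nat_mod.comp (nat_div.comp hs (p_pow2 (p_add (p_mul hn
    (p_add hP (const 1))) (nat_min.comp ha hP)))) (const 2)) (const 1)

theorem p_eq {f : α → ℕ} (hf : Primrec f) (c : ℕ) : PrimrecPred fun x => f x = c :=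
  Primrec.eq.comp hf (const c)

theorem p_iff {p q : α → Prop} (hp : PrimrecPred p) (hq : PrimrecPred q) :
    PrimrecPred fun x => (p x ∧ q x) ∨ (¬ p x ∧ ¬ q x) :=
  (hp.and hq).or (hp.not.and hq.not)

theorem p_Clause (m : ℕ) {W P s n a : α → ℕ} (hW : Primrec W) (hP : Primrec P) (hs : Primrec s)
    (hn : Primrec n) (ha : Primrec a) :
    PrimrecPred fun x => Clause m (W x) (P x) (s x) (n x) (a x) := by
  unfold Clause
  have t := p_u1 hn
  have b := p_B hP hs hn ha
  have hx := p_u1 (p_u2 hn)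
  have hy := p_u2 (p_u2 hn)
  refine PrimrecPred.and ?_ (PrimrecPred.and ?_ (PrimrecPred.and ?_ (PrimrecPred.and ?_ ?_)))
  · exact (p_eq t 0).not.or ((nat_lt.comp ha hW).not.or (p_iff b (p_B hP hs hn hP)))
  · exact (p_eq t 1).not.or b.not
  · exact (p_eq t 2).not.or (p_iff b ((p_B hP hs hx ha).not.or (p_B hP hs hy ha)))
  · exact (p_eq t 3).not.or (p_iff b (p_B hP hs (p_u2 hn) (p_add ha (const 1))))
  · refine (p_eq t 4).not.or (p_iff b (p_ex (const (m + 1)) ?_))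
    refine PrimrecPred.and ?_ (p_all fst ?_)
    · exact p_B (hP.comp snd) (hs.comp snd) (hy.comp snd) (p_add (ha.comp snd) fst)
    · exact p_B (hP.comp (snd.comp snd)) (hs.comp (snd.comp snd)) (hx.comp (snd.comp snd))
        (p_add (ha.comp (snd.comp snd)) fst)

theorem p_tl : Primrec tl := by
  unfold tl
  exact p_u2 (nat_sub.comp Primrec.id (const 1))

theorem p_Ref (m : ℕ) : PrimrecPred (Ref m) := by
  unfold Ref
  have hP : Primrec fun e => Pf m e := p_Pf m Primrec.id
  have hP1 : Primrec fun e => Pf m e + 1 := p_add hP (const 1)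
  have hE1 : Primrec fun e : ℕ => e + 1 := p_add Primrec.id (const 1)
  refine p_ex (p_pow2 (p_mul hE1 hP1)) ?_
  refine PrimrecPred.and ?_ (PrimrecPred.and ?_ ?_)
  · refine p_all (hE1.comp snd) ?_
    refine p_all (hP1.comp (snd.comp snd)) ?_
    exact p_Clause m (p_Wf m (snd.comp (snd.comp snd))) (p_Pf m (snd.comp (snd.comp snd)))
      (fst.comp (snd.comp snd)) (fst.comp snd) fst
  · refine p_all (hE1.comp snd) ?_
    have hit : Primrec fun q : ℕ × ℕ × ℕ => tl^[q.1] q.2.2.unpair.1 :=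
      nat_iterate fst (p_u1 (snd.comp snd)) (p_tl.comp₂ Primrec₂.right)
    refine (p_eq hit 0).or (p_all (hP1.comp (snd.comp snd)) ?_)
    exact p_B (hP.comp (snd.comp (snd.comp snd))) (fst.comp (snd.comp snd))
      (p_u1 (nat_sub.comp (hit.comp snd) (const 1))) fst
  · refine p_ex (hP1.comp snd) (PrimrecPred.not ?_)
    exact p_B (hP.comp (snd.comp snd)) (fst.comp snd) (p_u2 (snd.comp snd)) fst

end prim

theorem main (m : ℕ) : ∃ f : ℕ → Bool, Computable f ∧
      ∀ r : Rule, (f (encRule r) = true ↔ Admissible (LTLNTm m) r) := by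
  classical
  refine ⟨fun e => decide (¬ Ref m e), (p_Ref m).not.decide.to_comp, fun r => ?_⟩
  rw [decide_eq_true_iff, ← not_iff_not (b := Admissible (LTLNTm m) r), adm_iff, not_not]
  exact ⟨refU_of_ref m r, ref_of_refU m r⟩

end Adm15

/-- for every m ≥ 1, LTL_NT(m) is decidable with respect to
admissibility of inference rules. -/
theorem stmt15 (m : ℕ) (hm : 1 ≤ m) :
    ∃ f : ℕ → Bool, Computable f ∧
      ∀ r : Rule, (f (encRule r) = true ↔ Admissible (LTLNTm m) r) := by
  exact Adm15.main m
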